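/- arXiv:1203.3563 — 2 statements merged into one kernel-verified Lean document; each statement's English description precedes it below -/
import Mathlib

section
/- Let n ≥ 2, let u ∈ ℝⁿ be unit timelike, and let R be a symmetric real n×n matrix (a Ricci-like covariant rank-2 tensor). Then R is minimal with respect to u if and only if the vector R G_u R u is a scalar multiple of ηu, where G_u = η + 2uuᵀ; equivalently, if and only if u is an eigenvector of the operator η R G_u R. (For u = e₀ this is the condition that e₀ is an eigenvector of R², the Euclidean square of R.) -/
open Matrix

noncomputable section

/-- The Minkowski metric `η = diag(-1, 1, …, 1)` on `ℝⁿ`. -/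
def eta (n : ℕ) : Matrix (Fin n) (Fin n) ℝ :=
  Matrix.diagonal fun i => if i.val = 0 then (-1 : ℝ) else 1

/-- The Lorentz group `O(1,n-1)`: matrices with `Λᵀ η Λ = η`. -/
def IsLorentz {n : ℕ} (Λ : Matrix (Fin n) (Fin n) ℝ) : Prop :=
  Λᵀ * eta n * Λ = eta n

/-- `G_u = η + 2uuᵀ`. -/
def Gmat {n : ℕ} (u : Fin n → ℝ) : Matrix (Fin n) (Fin n) ℝ :=
  eta n + (2 : ℝ) • vecMulVec u u

/-- The Euclidean norm associated with `u` on `n×n` matrices: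
`‖A‖_u = √(tr(G_u A G_u Aᵀ))`. -/
def matNorm {n : ℕ} (u : Fin n → ℝ) (A : Matrix (Fin n) (Fin n) ℝ) : ℝ :=
  Real.sqrt (Matrix.trace (Gmat u * A * Gmat u * Aᵀ))

/-- A matrix `A` (covariant rank-2 tensor) is minimal with respect to `u` if
`‖ΛᵀAΛ‖_u ≥ ‖A‖_u` for every Lorentz `Λ`. -/
def IsMinimalMat {n : ℕ} (u : Fin n → ℝ) (A : Matrix (Fin n) (Fin n) ℝ) : Prop :=
  ∀ Λ : Matrix (Fin n) (Fin n) ℝ, IsLorentz Λ → matNorm u A ≤ matNorm u (Λᵀ * A * Λ)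

/-- The Minkowski bilinear form. -/
def mink {n : ℕ} (x y : Fin n → ℝ) : ℝ := x ⬝ᵥ (eta n).mulVec y

lemma eta_sq (n : ℕ) : eta n * eta n = 1 := by
  unfold eta
  rw [diagonal_mul_diagonal, ← diagonal_one]
  congr 1
  ext i
  split_ifs <;> simp

lemma eta_tr (n : ℕ) : (eta n)ᵀ = eta n := by
  unfold eta
  rw [diagonal_transpose]

lemma mink_comm {n : ℕ} (x y : Fin n → ℝ) : mink x y = mink y x := by
  unfold mink
  rw [dotProduct_mulVec, ← mulVec_transpose, eta_tr, dotProduct_comm]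

lemma mink_add_left {n : ℕ} (x y z : Fin n → ℝ) : mink (x + y) z = mink x z + mink y z := by
  simp [mink, add_dotProduct]

lemma mink_smul_left {n : ℕ} (a : ℝ) (x z : Fin n → ℝ) : mink (a • x) z = a * mink x z := by
  simp [mink]

lemma mink_add_right {n : ℕ} (x y z : Fin n → ℝ) : mink z (x + y) = mink z x + mink z y := by
  simp [mink, mulVec_add]

lemma mink_smul_right {n : ℕ} (a : ℝ) (x z : Fin n → ℝ) : mink z (a • x) = a * mink z x := by
  simp [mink, mulVec_smul]

lemma mink_eta_left {n : ℕ} (x y : Fin n → ℝ) : mink ((eta n).mulVec x) y = x ⬝ᵥ y := by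
  rw [mink_comm]
  unfold mink
  rw [mulVec_mulVec, eta_sq, one_mulVec, dotProduct_comm]

lemma mink_eta_eta {n : ℕ} (x y : Fin n → ℝ) :
    mink ((eta n).mulVec x) ((eta n).mulVec y) = mink x y := by
  rw [mink_eta_left]; rfl

lemma mink_succ {k : ℕ} (x y : Fin (k + 1) → ℝ) :
    mink x y = - (x 0 * y 0) + ∑ i : Fin k, x i.succ * y i.succ := by
  simp [mink, eta, mulVec_diagonal, dotProduct, Fin.sum_univ_succ]

lemma mink_pos {n : ℕ} (hn : 2 ≤ n) (u x : Fin n → ℝ) (hu : mink u u = -1) (hx : mink x u = 0) :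
    0 ≤ mink x x ∧ (mink x x = 0 → x = 0) := by
  obtain ⟨k, rfl⟩ : ∃ k, n = k + 1 := ⟨n - 1, by omega⟩
  rw [mink_succ] at *
  have cs := Finset.sum_mul_sq_le_sq_mul_sq Finset.univ
    (fun i : Fin k => x i.succ) (fun i : Fin k => u i.succ)
  have hX : 0 ≤ ∑ i : Fin k, x i.succ ^ 2 := Finset.sum_nonneg fun i _ => sq_nonneg _
  have hU : 0 ≤ ∑ i : Fin k, u i.succ ^ 2 := Finset.sum_nonneg fun i _ => sq_nonneg _
  simp only [← pow_two] at hu ⊢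
  have key : (∑ i : Fin k, x i.succ ^ 2) ≤
      (u 0) ^ 2 * (-(x 0) ^ 2 + ∑ i : Fin k, x i.succ ^ 2) := by
    have h1 : ∑ i : Fin k, x i.succ * u i.succ = x 0 * u 0 := by linarith
    rw [h1] at cs
    have h2 : ∑ i : Fin k, u i.succ ^ 2 = u 0 ^ 2 - 1 := by linarith
    rw [h2] at cs
    nlinarith
  have hu0 : 0 < u 0 ^ 2 := by linarith
  constructor
  · by_contra h
    push Not at h
    nlinarith
  · intro h
    rw [h] at key
    have hz : ∑ i : Fin k, x i.succ ^ 2 = 0 := by linarith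
    have h0 : x 0 = 0 := by
      rw [hz] at h
      have : x 0 ^ 2 = 0 := by linarith
      exact pow_eq_zero_iff (two_ne_zero) |>.1 this
    rw [Finset.sum_eq_zero_iff_of_nonneg (fun i _ => sq_nonneg _)] at hz
    ext i
    refine Fin.cases ?_ (fun j => ?_) i
    · exact h0
    · exact pow_eq_zero_iff (two_ne_zero) |>.1 (hz j (Finset.mem_univ j))

lemma mink_cs {n : ℕ} (hn : 2 ≤ n) (u x y : Fin n → ℝ) (hu : mink u u = -1) (hx : mink x u = 0)
    (hy : mink y u = 0) : mink x y ^ 2 ≤ mink x x * mink y y := by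
  obtain ⟨h1, h2⟩ := mink_pos hn u y hu hy
  rcases h1.eq_or_lt with h | h
  · have := h2 h.symm
    subst this
    simp [mink]
  · have h3 := (mink_pos hn u (mink y y • x + (-mink x y) • y) hu (by
      simp only [mink_add_left, mink_smul_left, hx, hy, mul_zero, add_zero])).1
    simp only [mink_add_left, mink_smul_left, mink_add_right, mink_smul_right,
      mink_comm y x] at h3
    have h4 : 0 ≤ mink y y * (mink x x * mink y y - mink x y ^ 2) := by nlinarith
    have := nonneg_of_mul_nonneg_right h4 h
    linarith

lemma perp_covec {n : ℕ} (u p : Fin n → ℝ) (hu : mink u u = -1) :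
    mink ((eta n).mulVec p + (p ⬝ᵥ u) • u) u = 0 := by
  simp [mink_add_left, mink_smul_left, hu, mink_eta_left]

lemma perp_covec_self {n : ℕ} (u p : Fin n → ℝ) (hu : mink u u = -1) :
    mink ((eta n).mulVec p + (p ⬝ᵥ u) • u) ((eta n).mulVec p + (p ⬝ᵥ u) • u)
      = mink p p + (p ⬝ᵥ u) ^ 2 := by
  simp only [mink_add_left, mink_smul_left, mink_add_right, mink_smul_right, hu, mink_eta_left,
    mink_comm u ((eta n).mulVec p)]
  rw [show p ⬝ᵥ (eta n).mulVec p = mink p p from rfl]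
  ring

lemma covec_cs {n : ℕ} (hn : 2 ≤ n) (u p y : Fin n → ℝ) (hu : mink u u = -1)
    (hy : mink y u = 0) : (p ⬝ᵥ y) ^ 2 ≤ (mink p p + (p ⬝ᵥ u) ^ 2) * mink y y := by
  have := mink_cs hn u _ y hu (perp_covec u p hu) hy
  rw [perp_covec_self u p hu] at this
  simpa [mink_add_left, mink_smul_left, mink_eta_left, mink_comm u y, hy] using this

/-- The `v`-dependent part of the squared norm. -/
def gfun {n : ℕ} (R : Matrix (Fin n) (Fin n) ℝ) (v : Fin n → ℝ) : ℝ :=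
  mink (R.mulVec v) (R.mulVec v) + (v ⬝ᵥ R.mulVec v) ^ 2

lemma sym_dot {n : ℕ} (R : Matrix (Fin n) (Fin n) ℝ) (hR : Rᵀ = R) (x y : Fin n → ℝ) :
    x ⬝ᵥ R.mulVec y = y ⬝ᵥ R.mulVec x := by
  rw [dotProduct_mulVec, ← mulVec_transpose, hR, dotProduct_comm]

lemma trace_eq {n : ℕ} (R : Matrix (Fin n) (Fin n) ℝ) (hR : Rᵀ = R) (v : Fin n → ℝ) :
    trace (Gmat v * R * Gmat v * R) = trace (eta n * R * eta n * R) + 4 * gfun R v := by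
  have e1 : trace (vecMulVec v v * R * eta n * R) = mink (R.mulVec v) (R.mulVec v) := by
    rw [Matrix.mul_assoc, Matrix.mul_assoc, vecMulVec_mul, trace_vecMulVec, mink,
      dotProduct_comm, ← dotProduct_mulVec, ← mulVec_mulVec, ← mulVec_mulVec, sym_dot R hR,
      dotProduct_comm]
  have e2 : trace (eta n * R * vecMulVec v v * R) = mink (R.mulVec v) (R.mulVec v) := by
    rw [Matrix.mul_assoc, Matrix.trace_mul_comm, ← e1]
    simp only [Matrix.mul_assoc]
  have e3 : trace (vecMulVec v v * R * vecMulVec v v * R) = (v ⬝ᵥ R.mulVec v) ^ 2 := by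
    rw [Matrix.mul_assoc, vecMulVec_mul v v R, vecMulVec_mul_vecMulVec, trace_vecMulVec]
    rw [dotProduct_smul, dotProduct_comm v (vecMul v R), ← dotProduct_mulVec]
    simp [pow_two]
  unfold Gmat gfun
  simp only [Matrix.add_mul, Matrix.mul_add, Matrix.smul_mul, Matrix.mul_smul, trace_add,
    trace_smul, e1, e2, e3, smul_eq_mul]
  ring

lemma lorentz_right {n : ℕ} {L : Matrix (Fin n) (Fin n) ℝ} (hL : IsLorentz L) :
    L * eta n * Lᵀ = eta n := by
  have h1 : (eta n * Lᵀ * eta n) * L = 1 := by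
    unfold IsLorentz at hL
    rw [Matrix.mul_assoc, Matrix.mul_assoc, ← Matrix.mul_assoc Lᵀ, hL, eta_sq]
  have h2 := mul_eq_one_comm.1 h1
  have h3 : L * eta n * Lᵀ * (eta n * eta n) = eta n := by
    calc _ = (L * (eta n * Lᵀ * eta n)) * eta n := by simp only [Matrix.mul_assoc]
      _ = _ := by rw [h2, Matrix.one_mul]
  rwa [eta_sq, Matrix.mul_one] at h3

lemma conj_G {n : ℕ} {L : Matrix (Fin n) (Fin n) ℝ} (hL : IsLorentz L) (u : Fin n → ℝ) :
    L * Gmat u * Lᵀ = Gmat (L.mulVec u) := by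
  unfold Gmat
  rw [Matrix.mul_add, Matrix.add_mul, lorentz_right hL, Matrix.mul_smul, Matrix.smul_mul,
    mul_vecMulVec, vecMulVec_mul, vecMul_transpose]

lemma trace_conj {n : ℕ} {L : Matrix (Fin n) (Fin n) ℝ} (hL : IsLorentz L) (u : Fin n → ℝ)
    (R : Matrix (Fin n) (Fin n) ℝ) (hR : Rᵀ = R) :
    trace (Gmat u * (Lᵀ * R * L) * Gmat u * (Lᵀ * R * L)ᵀ)
      = trace (eta n * R * eta n * R) + 4 * gfun R (L.mulVec u) := by
  rw [← trace_eq R hR, ← conj_G hL]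
  simp only [transpose_mul, transpose_transpose, hR]
  rw [show Gmat u * (Lᵀ * R * L) * Gmat u * (Lᵀ * (R * L))
    = (Gmat u * Lᵀ * R * L * Gmat u * Lᵀ * R) * L by simp only [Matrix.mul_assoc],
    Matrix.trace_mul_comm]
  simp only [Matrix.mul_assoc]

lemma mink_lorentz {n : ℕ} {L : Matrix (Fin n) (Fin n) ℝ} (hL : IsLorentz L) (u : Fin n → ℝ) :
    mink (L.mulVec u) (L.mulVec u) = mink u u := by
  unfold mink
  rw [← vecMul_transpose, ← dotProduct_mulVec, vecMul_transpose, mulVec_mulVec, mulVec_mulVec, hL]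

lemma G_psd {n : ℕ} (hn : 2 ≤ n) (u : Fin n → ℝ) (hu : mink u u = -1) : (Gmat u).PosSemidef := by
  refine .of_dotProduct_mulVec_nonneg ?_ fun x => ?_
  · rw [Matrix.IsHermitian, conjTranspose_eq_transpose_of_trivial]
    simp [Gmat, eta_tr, transpose_vecMulVec]
  · have h := (mink_pos hn u _ hu (perp_covec u x hu)).1
    rw [perp_covec_self u x hu] at h
    have : star x ⬝ᵥ Gmat u *ᵥ x = mink x x + 2 * (x ⬝ᵥ u) ^ 2 := by
      simp [Gmat, add_mulVec, smul_mulVec, vecMulVec_mulVec, mink, dotProduct_comm u x, pow_two]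
    rw [this]
    nlinarith [sq_nonneg (x ⬝ᵥ u)]

open scoped MatrixOrder in
lemma trace_nonneg' {n : ℕ} (hn : 2 ≤ n) (u : Fin n → ℝ) (hu : mink u u = -1)
    (A : Matrix (Fin n) (Fin n) ℝ) : 0 ≤ trace (Gmat u * A * Gmat u * Aᵀ) := by
  obtain ⟨B, hB⟩ := CStarAlgebra.nonneg_iff_eq_star_mul_self.1 (G_psd hn u hu).nonneg
  rw [hB, star_eq_conjTranspose, conjTranspose_eq_transpose_of_trivial]
  have : trace (Bᵀ * B * A * (Bᵀ * B) * Aᵀ) = trace ((B * A * Bᵀ) * (B * A * Bᵀ)ᵀ) := by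
    rw [show Bᵀ * B * A * (Bᵀ * B) * Aᵀ = Bᵀ * (B * A * Bᵀ * B * Aᵀ) by
      simp only [Matrix.mul_assoc], Matrix.trace_mul_comm]
    simp only [transpose_mul, transpose_transpose, Matrix.mul_assoc]
  rw [this, ← conjTranspose_eq_transpose_of_trivial (B * A * Bᵀ)]
  exact (posSemidef_self_mul_conjTranspose _).trace_nonneg

lemma exists_lorentz {n : ℕ} (u v : Fin n → ℝ) (hu : mink u u = -1) (hv : mink v v = -1)
    (h : mink u v ≠ -1) : ∃ L : Matrix (Fin n) (Fin n) ℝ, IsLorentz L ∧ L.mulVec u = v := by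
  set z := u + (-1 : ℝ) • v with hz
  have hzz : mink z z = -2 - 2 * mink u v := by
    simp only [hz, mink_add_left, mink_smul_left, mink_add_right, mink_smul_right, hu, hv,
      mink_comm v u]
    ring
  have hzu : mink z u = -1 - mink u v := by
    simp only [hz, mink_add_left, mink_smul_left, hu, mink_comm v u]
    ring
  set d := mink z z with hd
  have hd0 : d ≠ 0 := by
    intro h0
    apply h
    linarith
  refine ⟨1 - (2 / d) • vecMulVec z ((eta n).mulVec z), ?_, ?_⟩
  · unfold IsLorentz
    have e1 : vecMulVec ((eta n).mulVec z) z * eta n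
        = vecMulVec ((eta n).mulVec z) ((eta n).mulVec z) := by
      rw [vecMulVec_mul, ← mulVec_transpose, eta_tr]
    have e2 : eta n * vecMulVec z ((eta n).mulVec z)
        = vecMulVec ((eta n).mulVec z) ((eta n).mulVec z) := mul_vecMulVec _ _ _
    have e3 : vecMulVec ((eta n).mulVec z) ((eta n).mulVec z) * vecMulVec z ((eta n).mulVec z)
        = d • vecMulVec ((eta n).mulVec z) ((eta n).mulVec z) := by
      rw [vecMulVec_mul_vecMulVec, dotProduct_comm, vecMulVec_smul]
      rfl
    simp only [transpose_sub, transpose_one, transpose_smul, transpose_vecMulVec, Matrix.sub_mul,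
      Matrix.mul_sub, Matrix.one_mul, Matrix.mul_one, Matrix.smul_mul, Matrix.mul_smul, e1, e2, e3]
    match_scalars
    · ring
    · field_simp
      ring
  · have : (vecMulVec z ((eta n).mulVec z)).mulVec u = mink z u • z := by
      rw [vecMulVec_mulVec, mink_comm, mink, dotProduct_comm]
      simp
    rw [sub_mulVec, one_mulVec, smul_mulVec, this, smul_smul]
    have : 2 / d * mink z u = 1 := by
      rw [hzu]; field_simp; linarith
    rw [this, one_smul, hz]
    simp

lemma g_expand {n : ℕ} (R : Matrix (Fin n) (Fin n) ℝ) (hR : Rᵀ = R) (u y : Fin n → ℝ)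
    (α β m : ℝ) (hα : α ^ 2 = 1 + β ^ 2 * m) :
    gfun R (α • u + β • y) - gfun R u =
      β * (2 * α * (mink (R.mulVec u) (R.mulVec y) + 2 * (u ⬝ᵥ R.mulVec u) * (y ⬝ᵥ R.mulVec u))
      + β * ((m * mink (R.mulVec u) (R.mulVec u) + mink (R.mulVec y) (R.mulVec y)
        + 2 * (u ⬝ᵥ R.mulVec u) ^ 2 * m + 2 * (u ⬝ᵥ R.mulVec u) * (y ⬝ᵥ R.mulVec y))
      + ((u ⬝ᵥ R.mulVec u) * β * m + 2 * α * (y ⬝ᵥ R.mulVec u)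
        + β * (y ⬝ᵥ R.mulVec y)) ^ 2)) := by
  unfold gfun
  simp only [mulVec_add, mulVec_smul, mink_add_left, mink_smul_left, mink_add_right,
    mink_smul_right, mink_comm (R.mulVec y) (R.mulVec u), add_dotProduct, smul_dotProduct,
    dotProduct_add, dotProduct_smul, smul_eq_mul, sym_dot R hR u y]
  generalize mink (R.mulVec u) (R.mulVec u) = A
  generalize mink (R.mulVec u) (R.mulVec y) = B
  generalize mink (R.mulVec y) (R.mulVec y) = C
  generalize u ⬝ᵥ R.mulVec u = a
  generalize y ⬝ᵥ R.mulVec u = b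
  generalize y ⬝ᵥ R.mulVec y = c
  have e' : α * (α * a + β * b) + β * (α * b + β * c) =
    a + β * (a * β * m + 2 * α * b + β * c) := by linear_combination a * hα
  rw [e']
  linear_combination A * hα

lemma dot_RGRu {n : ℕ} (R : Matrix (Fin n) (Fin n) ℝ) (hR : Rᵀ = R) (u y : Fin n → ℝ) :
    y ⬝ᵥ (R * Gmat u * R).mulVec u =
      mink (R.mulVec u) (R.mulVec y) + 2 * (u ⬝ᵥ R.mulVec u) * (y ⬝ᵥ R.mulVec u) := by
  rw [← mulVec_mulVec, ← mulVec_mulVec, sym_dot R hR, dotProduct_comm]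
  unfold Gmat
  rw [add_mulVec, dotProduct_add, smul_mulVec, vecMulVec_mulVec, mink_comm (R.mulVec u)]
  simp only [mink, dotProduct_smul, smul_eq_mul, MulOpposite.smul_eq_mul_unop,
    MulOpposite.unop_op, dotProduct_comm (R.mulVec y) u, sym_dot R hR u y]
  ring

/-- A symmetric (Ricci-like) matrix `R` is minimal with respect to a unit timelike `u`
iff `R G_u R u` is a scalar multiple of `ηu`. -/
theorem stmt2 {n : ℕ} (hn : 2 ≤ n) (u : Fin n → ℝ)
    (hu : u ⬝ᵥ (eta n).mulVec u = -1)
    (R : Matrix (Fin n) (Fin n) ℝ) (hR : Rᵀ = R) :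
    IsMinimalMat u R ↔
      ∃ c : ℝ, (R * Gmat u * R).mulVec u = c • ((eta n).mulVec u) := by
  change mink u u = -1 at hu
  constructor
  · intro hmin
    have hg : ∀ v, mink v v = -1 → mink u v ≠ -1 → gfun R u ≤ gfun R v := by
      intro v hv huv
      obtain ⟨L, hL, rfl⟩ := exists_lorentz u v hu hv huv
      have h := hmin L hL
      unfold matNorm at h
      rw [Real.sqrt_le_sqrt_iff (trace_nonneg' hn u hu _), trace_conj hL u R hR, hR,
        trace_eq R hR] at h
      linarith
    have hD : ∀ y, mink y u = 0 → y ⬝ᵥ (R * Gmat u * R).mulVec u = 0 := by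
      intro y hy
      rw [dot_RGRu R hR]
      obtain ⟨hm, hm0⟩ := mink_pos hn u y hu hy
      rcases hm.eq_or_lt with h | h
      · have := hm0 h.symm
        subst this
        simp [mink]
      set m := mink y y with hmdef
      have hge : ∀ β : ℝ, 0 ≤ gfun R (√(1 + β ^ 2 * m) • u + β • y) - gfun R u := by
        intro β
        rcases eq_or_ne β 0 with rfl | hβ
        · simp
        have hpos : 0 < β ^ 2 * m := by positivity
        have hsq : √(1 + β ^ 2 * m) ^ 2 = 1 + β ^ 2 * m := Real.sq_sqrt (by linarith)
        rw [sub_nonneg]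
        apply hg
        · simp only [mink_add_left, mink_smul_left, mink_add_right, mink_smul_right,
            mink_comm u y, hy, hu, ← hmdef]
          linear_combination -hsq
        · simp only [mink_add_right, mink_smul_right, mink_comm u y, hy, hu]
          intro h1
          have : √(1 + β ^ 2 * m) = 1 := by linarith
          rw [this] at hsq
          linarith
      have hge2 := fun β : ℝ => (g_expand R hR u y (√(1 + β ^ 2 * m)) β m
        (Real.sq_sqrt (by positivity))) ▸ hge β
      generalize mink (R.mulVec u) (R.mulVec y) + 2 * (u ⬝ᵥ R.mulVec u) * (y ⬝ᵥ R.mulVec u) = D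
        at hge2 ⊢
      generalize (m * mink (R.mulVec u) (R.mulVec u) + mink (R.mulVec y) (R.mulVec y)
        + 2 * (u ⬝ᵥ R.mulVec u) ^ 2 * m + 2 * (u ⬝ᵥ R.mulVec u) * (y ⬝ᵥ R.mulVec y)) = E at hge2
      generalize u ⬝ᵥ R.mulVec u = a at hge2
      generalize y ⬝ᵥ R.mulVec u = b at hge2
      generalize y ⬝ᵥ R.mulVec y = c at hge2
      have hF : Continuous fun β : ℝ => 2 * √(1 + β ^ 2 * m) * D
        + β * (E + (a * β * m + 2 * √(1 + β ^ 2 * m) * b + β * c) ^ 2) := by fun_prop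
      have h0 := hF.tendsto 0
      simp only [ne_eq, OfNat.ofNat_ne_zero, not_false_eq_true, zero_pow, zero_mul, add_zero,
        Real.sqrt_one, mul_one] at h0
      have hp : 0 ≤ 2 * D := by
        refine ge_of_tendsto (h0.mono_left (nhdsWithin_le_nhds (s := Set.Ioi 0))) ?_
        filter_upwards [self_mem_nhdsWithin] with β hβ
        exact nonneg_of_mul_nonneg_right (hge2 β) hβ
      have hq : 2 * D ≤ 0 := by
        refine le_of_tendsto (h0.mono_left (nhdsWithin_le_nhds (s := Set.Iio 0))) ?_
        filter_upwards [self_mem_nhdsWithin] with β hβ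
        have h1 := hge2 β
        have h2 : β < 0 := hβ
        by_contra h3
        push Not at h3
        exact absurd h1 (not_le.2 (mul_neg_of_neg_of_pos h2 h3))
      linarith
    refine ⟨-(u ⬝ᵥ (R * Gmat u * R).mulVec u), ?_⟩
    ext i
    have := hD (Pi.single i 1 + (mink (Pi.single i 1) u) • u) (by
      simp [mink_add_left, mink_smul_left, hu])
    rw [add_dotProduct, smul_dotProduct, single_one_dotProduct] at this
    have e : mink (Pi.single i 1) u = (eta n).mulVec u i := by
      unfold mink; rw [single_one_dotProduct]
    rw [e] at this
    simp only [Pi.smul_apply, smul_eq_mul] at this ⊢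
    linarith
  · rintro ⟨k, hk⟩ L hL
    unfold matNorm
    apply Real.sqrt_le_sqrt
    rw [trace_conj hL u R hR, hR, trace_eq R hR]
    have hv := mink_lorentz hL u
    rw [hu] at hv
    set v := L.mulVec u
    set α := -mink v u with hα
    set y := v + (-α) • u with hy
    have hyu : mink y u = 0 := by
      simp [hy, mink_add_left, mink_smul_left, hu, hα]
    have hvy : v = α • u + (1 : ℝ) • y := by
      rw [hy]; module
    have hsq : α ^ 2 = 1 + 1 ^ 2 * mink y y := by
      rw [hvy] at hv
      simp only [mink_add_left, mink_smul_left, mink_add_right, mink_smul_right,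
        mink_comm u y, hyu, hu] at hv
      linarith
    have hexp := g_expand R hR u y α 1 (mink y y) hsq
    rw [← hvy] at hexp
    have hD := dot_RGRu R hR u y
    rw [hk, dotProduct_smul, show y ⬝ᵥ (eta n).mulVec u = 0 from hyu, smul_zero] at hD
    rw [← hD] at hexp
    obtain ⟨hm, hm0⟩ := mink_pos hn u y hu hyu
    have c1 := covec_cs hn u (R.mulVec u) y hu hyu
    have c2 := covec_cs hn u (R.mulVec y) y hu hyu
    rw [dotProduct_comm _ y, dotProduct_comm _ u] at c1 c2
    rw [sym_dot R hR u y] at c2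
    suffices h : 0 ≤ mink y y * mink (R.mulVec u) (R.mulVec u) + mink (R.mulVec y) (R.mulVec y)
        + 2 * (u ⬝ᵥ R.mulVec u) ^ 2 * mink y y + 2 * (u ⬝ᵥ R.mulVec u) * (y ⬝ᵥ R.mulVec y) by
      have := sq_nonneg ((u ⬝ᵥ R.mulVec u) * 1 * mink y y + 2 * α * (y ⬝ᵥ R.mulVec u)
        + 1 * (y ⬝ᵥ R.mulVec y))
      linarith
    rcases hm.eq_or_lt with h | h
    · have := hm0 h.symm
      rw [this]
      simp [mink]
    · refine nonneg_of_mul_nonneg_right (a := mink y y) ?_ h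
      generalize mink (R.mulVec u) (R.mulVec u) = A at *
      generalize mink (R.mulVec y) (R.mulVec y) = C at *
      generalize u ⬝ᵥ R.mulVec u = a at *
      generalize y ⬝ᵥ R.mulVec u = b at *
      generalize y ⬝ᵥ R.mulVec y = c at *
      generalize mink y y = m at *
      nlinarith [sq_nonneg (m * a + c), mul_le_mul_of_nonneg_left c1 h.le]

end
end

section
/- Let n ≥ 2 and let F be an antisymmetric real n×n matrix (a Maxwell-like covariant tensor). The Lorentz orbit of F contains an element of minimal Frobenius norm — i.e., there exists Λ₀ ∈ O(1,n−1) such that ‖Λ₀ᵀFΛ₀‖_F ≤ ‖ΛᵀFΛ‖_F for all Λ ∈ O(1,n−1) — if and only if it is NOT the case that F has exactly one aligned null direction; that is, if and only if ¬(there exists a null vector ℓ with Fℓ ∈ ℝ·(ηℓ) such that every null vector ℓ' with Fℓ' ∈ ℝ·(ηℓ') is a scalar multiple of ℓ). -/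
open Matrix

noncomputable section

/-- A null vector: nonzero with `vᵀηv = 0`. -/
def IsNull {n : ℕ} (v : Fin n → ℝ) : Prop :=
  v ≠ 0 ∧ v ⬝ᵥ (eta n).mulVec v = 0

/-- The Frobenius norm of a matrix. -/
def frobNorm {n : ℕ} (A : Matrix (Fin n) (Fin n) ℝ) : ℝ :=
  Real.sqrt (Matrix.trace (A * Aᵀ))

namespace Aux

/-- Minkowski product. -/
def B {n : ℕ} (x y : Fin n → ℝ) : ℝ := x ⬝ᵥ (eta n).mulVec y

/-- The endomorphism `η F`. -/
def A {n : ℕ} (F : Matrix (Fin n) (Fin n) ℝ) (x : Fin n → ℝ) : Fin n → ℝ :=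
  (eta n).mulVec (F.mulVec x)

section basic
variable {n : ℕ} (F : Matrix (Fin n) (Fin n) ℝ) (x y z : Fin n → ℝ) (t : ℝ)

lemma B_add_left : B (x + y) z = B x z + B y z := by simp [B, add_dotProduct]
lemma B_add_right : B x (y + z) = B x y + B x z := by simp [B, mulVec_add]
lemma B_smul_left : B (t • x) y = t * B x y := by simp [B]
lemma B_smul_right : B x (t • y) = t * B x y := by simp [B, mulVec_smul]
lemma A_add : A F (x + y) = A F x + A F y := by simp [A, mulVec_add]
lemma A_smul : A F (t • x) = t • A F x := by simp [A, mulVec_smul]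

lemma eta_T : (eta n)ᵀ = eta n := by simp [eta]

lemma eta_sq : eta n * eta n = 1 := by
  rw [eta, diagonal_mul_diagonal, ← diagonal_one]
  congr 1; ext i; split_ifs <;> norm_num

lemma eta_eta : (eta n).mulVec ((eta n).mulVec x) = x := by
  rw [mulVec_mulVec, eta_sq, one_mulVec]

lemma B_comm : B x y = B y x := by
  rw [B, dotProduct_mulVec, ← mulVec_transpose, eta_T, dotProduct_comm, B]

lemma B_A_right : B x (A F y) = x ⬝ᵥ F.mulVec y := by
  rw [B, A, eta_eta]

lemma B_A_skew (hF : Fᵀ = -F) : B x (A F y) = - B (A F x) y := by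
  rw [B_comm (A F x), B_A_right, B_A_right, dotProduct_mulVec, ← mulVec_transpose, hF,
    neg_mulVec, neg_dotProduct, dotProduct_comm]

lemma B_A_self (hF : Fᵀ = -F) : B x (A F x) = 0 := by
  have := B_A_skew F x x hF
  rw [B_comm (A F x)] at this
  linarith

lemma B_A_A : B (A F x) (A F x) = F.mulVec x ⬝ᵥ (eta n).mulVec (F.mulVec x) := by
  rw [B_A_right, A, dotProduct_comm]

lemma aligned_iff (c : ℝ) : F.mulVec x = c • (eta n).mulVec x ↔ A F x = c • x := by
  constructor
  · intro h; rw [A, h, mulVec_smul, eta_eta]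
  · intro h; rw [← mulVec_smul, ← h, A, eta_eta]

lemma null_iff : IsNull x ↔ x ≠ 0 ∧ B x x = 0 := Iff.rfl

end basic

section succ
variable {m : ℕ} (F : Matrix (Fin (m+1)) (Fin (m+1)) ℝ) (x y z : Fin (m+1) → ℝ)

lemma B_eq : B x y = - (x 0 * y 0) + ∑ i : Fin m, x i.succ * y i.succ := by
  simp [B, eta, mulVec_diagonal, dotProduct, Fin.sum_univ_succ]

lemma cone_ne (hx : x ≠ 0) (h : B x x ≤ 0) : x 0 ≠ 0 := by
  intro h0
  rw [B_eq, h0] at h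
  have h1 : ∑ i : Fin m, x i.succ * x i.succ = 0 :=
    le_antisymm (by linarith) (Finset.sum_nonneg fun i _ => mul_self_nonneg _)
  rw [Finset.sum_eq_zero_iff_of_nonneg (fun i _ => mul_self_nonneg _)] at h1
  apply hx
  ext i
  refine Fin.cases h0 (fun j => ?_) i
  simpa using h1 j (Finset.mem_univ _)

lemma pos_of_zero (h0 : x 0 = 0) : 0 ≤ B x x := by
  rw [B_eq, h0]
  have := Finset.sum_nonneg (s := Finset.univ) fun (i : Fin m) _ => mul_self_nonneg (x i.succ)
  linarith

lemma decomp (u w : Fin (m+1) → ℝ) (hu : u ≠ 0) (h : B u u ≤ 0) (hw : B u w = 0) :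
    0 ≤ B w w ∧ (B w w = 0 → ∃ t : ℝ, w = t • u) := by
  have hu0 := cone_ne u hu h
  set t := w 0 / u 0 with ht
  set z := w + (-t) • u with hz
  have hz0 : z 0 = 0 := by simp [hz, ht, hu0]
  have hzz : B z z = B w w + t ^ 2 * B u u := by
    simp only [hz, B_add_left, B_add_right, B_smul_left, B_smul_right, B_comm w u, hw]; ring
  have hzp := pos_of_zero z hz0
  have : t ^ 2 * B u u ≤ 0 := mul_nonpos_of_nonneg_of_nonpos (sq_nonneg t) h
  refine ⟨by linarith, fun h0 => ⟨t, ?_⟩⟩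
  have hz00 : z = 0 := by
    by_contra hne
    exact cone_ne z hne (by linarith) hz0
  have := congrArg (· + t • u) hz00
  simpa [hz] using this

lemma time_ne (u : Fin (m+1) → ℝ) (h : B u u < 0) : u ≠ 0 := by
  rintro rfl
  simp [B] at h

lemma time_perp (u w : Fin (m+1) → ℝ) (h : B u u < 0) (hw : B u w = 0) :
    0 ≤ B w w ∧ (B w w = 0 → w = 0) := by
  obtain ⟨h1, h2⟩ := decomp u w (time_ne u h) h.le hw
  refine ⟨h1, fun h0 => ?_⟩
  obtain ⟨t, rfl⟩ := h2 h0
  rw [B_smul_right] at hw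
  have : t = 0 := (mul_eq_zero.1 hw).resolve_right h.ne
  simp [this]

/-- Electric energy. -/
def q (x : Fin (m+1) → ℝ) : ℝ := B (A F x) (A F x)

lemma lor_symm {L : Matrix (Fin (m+1)) (Fin (m+1)) ℝ} (hL : IsLorentz L) :
    L * eta _ * Lᵀ = eta _ := by
  have h1 : (eta (m+1) * Lᵀ * eta _) * L = 1 := by
    have : eta (m+1) * (Lᵀ * eta _ * L) = 1 := by rw [hL, eta_sq]
    simpa only [Matrix.mul_assoc] using this
  have h2 := mul_eq_one_comm.1 h1
  have h3 : (L * (eta (m+1) * Lᵀ * eta _)) * eta _ = eta _ := by rw [h2, Matrix.one_mul]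
  simpa only [Matrix.mul_assoc, eta_sq, Matrix.mul_one] using h3

lemma trace_skew (G : Matrix (Fin (m+1)) (Fin (m+1)) ℝ) (hG : Gᵀ = -G) :
    trace (G * Gᵀ) = trace (G * eta _ * Gᵀ * eta _) +
      4 * (G.mulVec (Pi.single 0 1) ⬝ᵥ (eta _).mulVec (G.mulVec (Pi.single 0 1))) := by
  have hs : ∀ i j, G i j = - G j i := fun i j => by
    have := congrFun (congrFun hG j) i
    simpa using this
  have h00 : G 0 0 = 0 := by have := hs 0 0; linarith
  have h0 : ∀ j : Fin m, G 0 j.succ = - G j.succ 0 := fun j => hs _ _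
  have h1 : trace (G * eta _ * Gᵀ * eta _) = ∑ i, ∑ j, (if i = 0 then (-1 : ℝ) else 1) *
      (if j = 0 then (-1 : ℝ) else 1) * (G i j * G i j) := by
    unfold eta trace
    refine Finset.sum_congr rfl fun i _ => ?_
    rw [diag_apply, mul_diagonal, Matrix.mul_apply, Finset.sum_mul]
    refine Finset.sum_congr rfl fun j _ => ?_
    rw [mul_diagonal, transpose_apply]
    simp only [Fin.val_eq_zero_iff]
    ring
  rw [h1]
  simp [trace, eta, Matrix.mul_apply, mulVec_diagonal, dotProduct, Fin.sum_univ_succ, h00, h0,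
    Finset.sum_add_distrib]
  ring

lemma frob_eq (hF : Fᵀ = -F) {L : Matrix (Fin (m+1)) (Fin (m+1)) ℝ} (hL : IsLorentz L) :
    trace ((Lᵀ * F * L) * (Lᵀ * F * L)ᵀ) = trace (F * eta _ * Fᵀ * eta _) +
      4 * q F (L.mulVec (Pi.single 0 1)) := by
  have hLs := lor_symm hL
  have hG : (Lᵀ * F * L)ᵀ = -(Lᵀ * F * L) := by
    simp [Matrix.transpose_mul, hF, Matrix.mul_assoc]
  rw [trace_skew _ hG]
  congr 1
  · have : (Lᵀ * F * L) * eta _ * (Lᵀ * F * L)ᵀ * eta _ =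
        Lᵀ * (F * (L * eta _ * Lᵀ) * Fᵀ * L * eta _) := by
      simp only [Matrix.transpose_mul, Matrix.transpose_transpose, Matrix.mul_assoc]
    rw [this, hLs, trace_mul_comm]
    have : F * eta _ * Fᵀ * L * eta _ * Lᵀ = F * eta _ * Fᵀ * (L * eta _ * Lᵀ) := by
      simp only [Matrix.mul_assoc]
    rw [this, hLs]
  · rw [q, B_A_A]
    congr 1
    set u := L.mulVec (Pi.single 0 1) with hu
    have : (Lᵀ * F * L).mulVec (Pi.single 0 1) = Lᵀ.mulVec (F.mulVec u) := by
      simp only [hu, mulVec_mulVec, Matrix.mul_assoc]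
    rw [this]
    conv_rhs => rw [← hLs]
    rw [mulVec_transpose, ← dotProduct_mulVec, ← mulVec_transpose]
    simp [mulVec_mulVec, Matrix.mul_assoc]

lemma lor_time {L : Matrix (Fin (m+1)) (Fin (m+1)) ℝ} (hL : IsLorentz L) :
    B (L.mulVec (Pi.single 0 1)) (L.mulVec (Pi.single 0 1)) = -1 := by
  have h1 : B (L.mulVec (Pi.single 0 1)) (L.mulVec (Pi.single 0 1)) =
      B (Pi.single (0 : Fin (m+1)) 1) (Pi.single (0 : Fin (m+1)) 1) := by
    unfold B
    conv_rhs => rw [← hL]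
    rw [← vecMul_transpose, ← dotProduct_mulVec, vecMul_transpose]
    simp only [mulVec_mulVec, Matrix.mul_assoc]
  rw [h1, B_eq]; simp

lemma q_neg : q F (-x) = q F x := by
  have : -x = (-1 : ℝ) • x := by simp
  rw [q, this, A_smul, B_smul_left, B_smul_right, q]; ring

lemma exists_lor (u : Fin (m+1) → ℝ) (hu : B u u = -1) :
    ∃ L, IsLorentz L ∧ (L.mulVec (Pi.single 0 1) = u ∨ L.mulVec (Pi.single 0 1) = -u) := by
  wlog h0 : 0 < u 0 generalizing u
  · have hne := cone_ne u (time_ne u (by linarith)) (by linarith)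
    have hn : 0 < (-u) 0 := by
      have : u 0 < 0 := lt_of_le_of_ne (not_lt.1 h0) hne
      simpa using this
    have hB : B (-u) (-u) = -1 := by simpa [B, mulVec_neg] using hu
    obtain ⟨L, h1, h2⟩ := this (-u) hB hn
    exact ⟨L, h1, by simpa using h2.symm⟩
  set e : Fin (m+1) → ℝ := Pi.single 0 1 with he
  set w := u + e with hw
  have hee : B e e = -1 := by rw [B_eq]; simp [he]
  have hue : B u e = - u 0 := by rw [B_eq]; simp [he]
  have hww : B w w = -2 - 2 * u 0 := by
    simp only [hw, B_add_left, B_add_right, B_comm e u, hee, hue, hu]; ring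
  have hwe : B w e = -1 - u 0 := by
    simp only [hw, B_add_left, hee, hue]; ring
  have hne : B w w ≠ 0 := by rw [hww]; linarith
  set k := 2 / B w w with hk
  refine ⟨1 - k • vecMulVec w ((eta _).mulVec w), ?_, Or.inr ?_⟩
  · have hB : w ⬝ᵥ (eta _).mulVec w = B w w := rfl
    have hv : (w ᵥ* eta _) = (eta _).mulVec w := by rw [← mulVec_transpose, eta_T]
    have hB2 : (eta (m+1)).mulVec w ⬝ᵥ w = B w w := by rw [dotProduct_comm]; rfl
    set b := (eta (m+1)).mulVec w with hb
    have hk2 : k * B w w = 2 := by rw [hk]; field_simp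
    have e1 : vecMulVec b w * eta _ = vecMulVec b b := by rw [vecMulVec_mul, hv]
    have e2 : eta _ * vecMulVec w b = vecMulVec b b := by rw [mul_vecMulVec]
    have e3 : vecMulVec b b * vecMulVec w b = B w w • vecMulVec b b := by
      rw [vecMulVec_mul_vecMulVec, hB2]
      ext i j; simp [vecMulVec_apply]; try ring
    unfold IsLorentz
    rw [transpose_sub, transpose_one, transpose_smul, transpose_vecMulVec,
      Matrix.sub_mul, Matrix.one_mul, Matrix.mul_sub, Matrix.mul_one, Matrix.smul_mul,
      Matrix.mul_smul, e1, Matrix.sub_mul, Matrix.smul_mul, e2, e3]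
    have : k • (vecMulVec b b - k • B w w • vecMulVec b b) =
        k • vecMulVec b b - k • (k * B w w) • vecMulVec b b := by
      rw [smul_sub, smul_smul k (B w w)]
    rw [this, hk2]
    module
  · rw [sub_mulVec, one_mulVec, smul_mulVec, vecMulVec_mulVec]
    have : (eta (m+1)).mulVec w ⬝ᵥ e = B w e := by rw [B_comm, dotProduct_comm]; rfl
    rw [this]
    have hk2 : k * B w e = 1 := by
      have h3 : B w w = 2 * B w e := by rw [hww, hwe]; ring
      have h4 : B w e ≠ 0 := by rw [hwe]; linarith
      rw [hk, h3]; field_simp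
    ext i
    have : k * (w i * B w e) = w i := by linear_combination (w i) * hk2
    have h5 : w i = u i + e i := rfl
    simp only [Pi.sub_apply, Pi.smul_apply, Pi.neg_apply, smul_eq_mul, MulOpposite.smul_eq_mul_unop,
      MulOpposite.unop_op]
    rw [this, h5]; ring

/-- reduction to quadratic form on the hyperboloid -/
lemma min_iff (hF : Fᵀ = -F) :
    (∃ L₀ : Matrix (Fin (m+1)) (Fin (m+1)) ℝ, IsLorentz L₀ ∧
      ∀ L : Matrix (Fin (m+1)) (Fin (m+1)) ℝ, IsLorentz L →
        frobNorm (L₀ᵀ * F * L₀) ≤ frobNorm (Lᵀ * F * L)) ↔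
    ∃ u, B u u = -1 ∧ ∀ x, B x x = -1 → q F u ≤ q F x := by
  have key : ∀ L L' : Matrix (Fin (m+1)) (Fin (m+1)) ℝ, IsLorentz L → IsLorentz L' →
      (frobNorm (Lᵀ * F * L) ≤ frobNorm (L'ᵀ * F * L') ↔
        q F (L.mulVec (Pi.single 0 1)) ≤ q F (L'.mulVec (Pi.single 0 1))) := by
    intro L L' hL hL'
    have hnn : 0 ≤ trace ((L'ᵀ * F * L') * (L'ᵀ * F * L')ᵀ) := by
      simp only [trace, Matrix.diag, Matrix.mul_apply, transpose_apply]
      exact Finset.sum_nonneg fun i _ => Finset.sum_nonneg fun j _ => mul_self_nonneg _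
    unfold frobNorm
    rw [Real.sqrt_le_sqrt_iff hnn, frob_eq F hF hL, frob_eq F hF hL']
    constructor <;> intro h <;> linarith
  have hq : ∀ u, B u u = -1 → ∃ L, IsLorentz L ∧ q F (L.mulVec (Pi.single 0 1)) = q F u := by
    intro u hu
    obtain ⟨L, hL, h | h⟩ := exists_lor u hu
    · exact ⟨L, hL, by rw [h]⟩
    · exact ⟨L, hL, by rw [h, q_neg]⟩
  constructor
  · rintro ⟨L, hL, h⟩
    refine ⟨_, lor_time hL, fun x hx => ?_⟩
    obtain ⟨L', hL', e⟩ := hq x hx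
    rw [← e]
    exact (key _ _ hL hL').1 (h L' hL')
  · rintro ⟨u, hu, h⟩
    obtain ⟨L, hL, e⟩ := hq u hu
    refine ⟨L, hL, fun L' hL' => (key _ _ hL hL').2 ?_⟩
    rw [e]
    exact h _ (lor_time hL')

end succ
end Aux
namespace Aux
section main
variable {m : ℕ} (F : Matrix (Fin (m+1)) (Fin (m+1)) ℝ)

/-- `c` aligned null direction -/
def AND (l : Fin (m+1) → ℝ) : Prop := IsNull l ∧ ∃ c : ℝ, A F l = c • l

lemma q_smul (x : Fin (m+1) → ℝ) (t : ℝ) : q F (t • x) = t ^ 2 * q F x := by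
  rw [q, A_smul, B_smul_left, B_smul_right, q]; ring

lemma q_nonneg (hF : Fᵀ = -F) (x : Fin (m+1) → ℝ) (h : B x x ≤ 0) (hx : x ≠ 0) : 0 ≤ q F x :=
  (decomp x _ hx h (B_A_self F x hF)).1

lemma B_cont : Continuous fun x : Fin (m+1) → ℝ => B x x := by
  unfold B; fun_prop

lemma q_cont : Continuous (q F) := by
  unfold q B A; fun_prop

lemma scale (x : Fin (m+1) → ℝ) (h : B x x < 0) :
    ∃ t : ℝ, B (t • x) (t • x) = -1 ∧ t ^ 2 * (- B x x) = 1 := by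
  have h1 : 0 < - B x x := by linarith
  have h2 : (1 / Real.sqrt (- B x x)) ^ 2 * (- B x x) = 1 := by
    rw [div_pow, Real.sq_sqrt h1.le, one_pow, one_div, inv_mul_cancel₀ h1.ne']
  refine ⟨1 / Real.sqrt (- B x x), ?_, h2⟩
  rw [B_smul_left, B_smul_right]; linarith

lemma min_cone (u : Fin (m+1) → ℝ) (hmin : ∀ x, B x x = -1 → q F u ≤ q F x)
    (x : Fin (m+1) → ℝ) (h : B x x < 0) : 0 ≤ q F x + q F u * B x x := by
  obtain ⟨t, h1, h2⟩ := scale x h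
  have h3 := hmin _ h1
  rw [q_smul] at h3
  have h4 : 0 < t ^ 2 := by
    rcases (sq_nonneg t).lt_or_eq with h | h
    · exact h
    · rw [← h] at h2; simp at h2
  have : 0 ≤ t ^ 2 * (q F x + q F u * B x x) := by
    have : t ^ 2 * (q F u * B x x) = - q F u := by linear_combination (- q F u) * h2
    linarith
  exact nonneg_of_mul_nonneg_right this h4

/-- criticality at a minimum -/
lemma crit (hF : Fᵀ = -F) (u : Fin (m+1) → ℝ) (hu : B u u = -1)
    (hmin : ∀ x, B x x = -1 → q F u ≤ q F x) : A F (A F u) = q F u • u := by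
  have key : ∀ y, B (A F u) (A F y) + q F u * B u y = 0 := by
    intro y
    set b := B (A F u) (A F y) + q F u * B u y with hb
    set c := q F y + q F u * B y y with hc
    have hexp : ∀ t : ℝ, q F (u + t • y) + q F u * B (u + t • y) (u + t • y)
        = 2 * t * b + t ^ 2 * c := by
      intro t
      have : q F u = B (A F u) (A F u) := rfl
      simp only [hb, hc, q, A_add, A_smul, B_add_left, B_add_right, B_smul_left, B_smul_right,
        B_comm (A F y) (A F u), B_comm y u, hu]
      ring
    have hev : ∀ᶠ t : ℝ in nhds 0, 0 ≤ 2 * t * b + t ^ 2 * c := by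
      have hcont : Continuous fun t : ℝ => B (u + t • y) (u + t • y) :=
        B_cont.comp (by fun_prop)
      have : ∀ᶠ t : ℝ in nhds 0, B (u + t • y) (u + t • y) < 0 := by
        apply hcont.continuousAt.eventually_lt continuousAt_const
        simp [hu]
      filter_upwards [this] with t ht
      rw [← hexp]
      exact min_cone F u hmin _ ht
    have hloc : IsLocalMin (fun t : ℝ => 2 * t * b + t ^ 2 * c) 0 := by
      filter_upwards [hev] with t ht
      simpa using ht
    have hd : HasDerivAt (fun t : ℝ => 2 * t * b + t ^ 2 * c) (2 * b) 0 := by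
      have h1 := ((hasDerivAt_id (0:ℝ)).const_mul 2).mul_const b
      have h2 := ((hasDerivAt_id (0:ℝ)).pow 2).mul_const c
      have h3 := h1.add h2
      exact h3.congr_deriv (by simp)
    have := hloc.hasDerivAt_eq_zero hd
    linarith
  have h2 : ∀ y, B y (A F (A F u) + (- q F u) • u) = 0 := by
    intro y
    rw [B_add_right, B_smul_right, B_A_skew F _ _ hF, B_comm (A F y), B_comm y u]
    linarith [key y]
  have h3 : (eta (m+1)).mulVec (A F (A F u) + (- q F u) • u) = 0 := by
    apply dotProduct_self_eq_zero.1
    exact h2 _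
  have h4 : A F (A F u) + (- q F u) • u = 0 := by
    rw [← eta_eta (A F (A F u) + (- q F u) • u), h3, mulVec_zero]
  have := congrArg (· + q F u • u) h4
  simpa using this

lemma not_unique_of_min (hF : Fᵀ = -F) (u : Fin (m+1) → ℝ) (hu : B u u = -1)
    (hmin : ∀ x, B x x = -1 → q F u ≤ q F x) (l : Fin (m+1) → ℝ) (hl : AND F l)
    (huniq : ∀ l', AND F l' → ∃ t : ℝ, l' = t • l) : False := by
  have hcrit := crit F hF u hu hmin
  have hun : u ≠ 0 := time_ne u (by linarith)
  have hq0 := q_nonneg F hF u (by linarith) hun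
  obtain ⟨⟨hl0, hll⟩, c, hc⟩ := hl
  change B l l = 0 at hll
  rcases hq0.lt_or_eq with hq | hq
  · -- boost
    set s := Real.sqrt (q F u) with hs
    have hs2 : s * s = q F u := Real.mul_self_sqrt hq0
    have hs0 : 0 < s := Real.sqrt_pos.2 hq
    have huA := B_A_self F u hF
    have hqd : B (A F u) (A F u) = s * s := hs2.symm
    have main : ∀ r : ℝ, r * r = s * s → AND F (r • u + A F u) := by
      intro r hr
      refine ⟨⟨?_, ?_⟩, r, ?_⟩
      · intro h0
        have : B u (r • u + A F u) = 0 := by rw [h0]; simp [B]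
        rw [B_add_right, B_smul_right, hu, huA] at this
        have : r = 0 := by linarith
        rw [this] at hr
        nlinarith
      · change B _ _ = 0
        simp only [B_add_left, B_add_right, B_smul_left, B_smul_right, B_comm (A F u) u, huA, hu,
          hqd]
        linarith
      · rw [A_add, A_smul, hcrit, ← hs2, ← hr]; module
    obtain ⟨t1, h1⟩ := huniq _ (main s rfl)
    obtain ⟨t2, h2⟩ := huniq _ (main (-s) (by ring))
    have hz : B (s • u + A F u) ((-s) • u + A F u) = 0 := by
      rw [h1, h2, B_smul_left, B_smul_right, hll]; ring
    simp only [B_add_left, B_add_right, B_smul_left, B_smul_right, B_comm (A F u) u, huA, hu,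
          hqd] at hz
    nlinarith
  · -- A u = 0
    have hAu : A F u = 0 :=
      (time_perp u _ (by linarith) (B_A_self F u hF)).2 hq.symm
    have hul : B u l ≠ 0 := by
      intro h0
      exact hl0 ((time_perp u l (by linarith) h0).2 hll)
    have hc0 : c = 0 := by
      have h1 := B_A_skew F u l hF
      rw [hAu, hc, B_smul_right] at h1
      have : c * B u l = 0 := by rw [h1]; simp [B]
      exact (mul_eq_zero.1 this).resolve_right hul
    set k := B u l with hk
    -- reflected vector
    have hA : AND F ((-2 * k) • u + (-1 : ℝ) • l) := by
      refine ⟨⟨?_, ?_⟩, 0, ?_⟩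
      · intro h0
        have : B u ((-2 * k) • u + (-1 : ℝ) • l) = 0 := by rw [h0]; simp [B]
        rw [B_add_right, B_smul_right, B_smul_right, hu, ← hk] at this
        apply hul; linarith
      · change B _ _ = 0
        simp only [B_add_left, B_add_right, B_smul_left, B_smul_right, B_comm l u, hu, ← hk, hll]
        ring
      · rw [A_add, A_smul, A_smul, hAu, hc, hc0]; simp
    obtain ⟨t, ht⟩ := huniq _ hA
    have h0 : B l ((-2 * k) • u + (-1 : ℝ) • l) = 0 := by
      rw [ht, B_smul_right, hll]; ring
    rw [B_add_right, B_smul_right, B_smul_right, B_comm l u, ← hk, hll] at h0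
    have : k * k = 0 := by linarith
    exact hul (mul_self_eq_zero.1 this)

/-- two aligned null directions give a minimum -/
lemma min_of_two (hF : Fᵀ = -F) (l k : Fin (m+1) → ℝ) (hl : AND F l) (hk : AND F k)
    (hne : ¬ ∃ t : ℝ, k = t • l) :
    ∃ u, B u u = -1 ∧ ∀ x, B x x = -1 → q F u ≤ q F x := by
  obtain ⟨⟨hl0, hll⟩, c, hc⟩ := hl
  obtain ⟨⟨hk0, hkk⟩, d, hd⟩ := hk
  change B l l = 0 at hll
  change B k k = 0 at hkk
  have hlk : B l k ≠ 0 := fun h0 => hne ((decomp l k hl0 hll.le h0).2 hkk)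
  have hdc : d = -c := by
    have h1 := B_A_skew F l k hF
    rw [hc, hd, B_smul_left, B_smul_right] at h1
    have : (d + c) * B l k = 0 := by linarith
    have := (mul_eq_zero.1 this).resolve_right hlk
    linarith
  subst hdc
  set p := B l k with hp
  -- q on the plane plus the orthogonal part
  have hdec : ∀ x, ∃ a b : ℝ, ∃ w, x = a • l + b • k + w ∧ B l w = 0 ∧ B k w = 0 := by
    intro x
    refine ⟨B k x / p, B l x / p, x + (-(B k x / p)) • l + (-(B l x / p)) • k, by module, ?_, ?_⟩
    · simp only [B_add_right, B_smul_right, hll, ← hp]; field_simp; ring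
    · simp only [B_add_right, B_smul_right, hkk, B_comm k l, ← hp]; field_simp; ring
  obtain ⟨u, hu, a, b, hab⟩ : ∃ u, B u u = -1 ∧ ∃ a b : ℝ, u = a • l + b • k := by
    refine ⟨l + (-1 / (2 * p)) • k, ?_, 1, _, by rw [one_smul]⟩
    simp only [B_add_left, B_add_right, B_smul_left, B_smul_right, B_comm k l, hll, hkk, ← hp]
    field_simp; ring
  have hBw : ∀ (a b : ℝ) w, B l w = 0 → B k w = 0 →
      B (a • l + b • k + w) (a • l + b • k + w) = 2 * a * b * p + B w w := by
    intro a b w h1 h2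
    simp only [B_add_left, B_add_right, B_smul_left, B_smul_right, B_comm k l, B_comm w l,
      B_comm w k, hll, hkk, ← hp, h1, h2]
    ring
  have hqw : ∀ (a b : ℝ) w, B l w = 0 → B k w = 0 →
      q F (a • l + b • k + w) = - c ^ 2 * (2 * a * b * p) + q F w := by
    intro a b w h1 h2
    have h3 : B l (A F w) = 0 := by rw [B_A_skew F _ _ hF, hc, B_smul_left, h1]; ring
    have h4 : B k (A F w) = 0 := by rw [B_A_skew F _ _ hF, hd, B_smul_left, h2]; ring
    have h5 : A F (a • l + b • k + w) = (a * c) • l + (b * -c) • k + A F w := by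
      simp only [A_add, A_smul, hc, hd, smul_smul]
    rw [q, h5, hBw _ _ _ h3 h4, q]
    ring
  refine ⟨u, hu, fun x hx => ?_⟩
  obtain ⟨a', b', w, rfl, h1, h2⟩ := hdec x
  have hz : q F (0 : Fin (m+1) → ℝ) = 0 := by simp [q, A, B]
  have hu' : u = a • l + b • k + 0 := by rw [hab, add_zero]
  have hl00 : B l (0 : Fin (m+1) → ℝ) = 0 := by simp [B]
  have hk00 : B k (0 : Fin (m+1) → ℝ) = 0 := by simp [B]
  have e1 := hBw a b 0 hl00 hk00
  have e2 := hqw a b 0 hl00 hk00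
  rw [← hu'] at e1 e2
  have h00 : B (0 : Fin (m+1) → ℝ) 0 = 0 := by simp [B]
  rw [hqw _ _ _ h1 h2, e2, hz]
  rw [hBw _ _ _ h1 h2] at hx
  have hw0 : 0 ≤ B w w := (decomp l w hl0 hll.le h1).1
  have hA0 : 0 ≤ q F w := by
    refine (decomp l (A F w) hl0 hll.le ?_).1
    rw [B_A_skew F _ _ hF, hc, B_smul_left, h1]; ring
  have := mul_nonneg (sq_nonneg c) hw0
  rw [hu, h00] at e1
  have e3 : 2 * a * b * p = -1 := by linarith
  have e4 : 2 * a' * b' * p = -1 - B w w := by linarith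
  rw [e3, e4]
  nlinarith

/-- no aligned null direction gives a minimum -/
lemma min_of_none (hF : Fᵀ = -F) (hno : ∀ l, ¬ AND F l) :
    ∃ u, B u u = -1 ∧ ∀ x, B x x = -1 → q F u ≤ q F x := by
  by_cases hex : ∃ x, B x x < 0 ∧ q F x = 0
  · obtain ⟨x, hx, hq⟩ := hex
    obtain ⟨t, h1, -⟩ := scale x hx
    refine ⟨t • x, h1, fun y hy => ?_⟩
    rw [q_smul, hq, mul_zero]
    exact q_nonneg F hF y (by linarith) (time_ne y (by linarith))
  push Not at hex
  have hpos : ∀ x, x ≠ 0 → B x x ≤ 0 → 0 < q F x := by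
    intro x hx h
    refine lt_of_le_of_ne (q_nonneg F hF x h hx) fun h0 => ?_
    rcases h.lt_or_eq with h | h
    · exact hex x h h0.symm
    · obtain ⟨t, ht⟩ := (decomp x _ hx h.le (B_A_self F x hF)).2 h0.symm
      exact hno x ⟨⟨hx, h⟩, t, ht⟩
  have hee : B (Pi.single (0 : Fin (m+1)) (1 : ℝ)) (Pi.single (0 : Fin (m+1)) (1 : ℝ)) = -1 := by
    rw [B_eq]; simp
  obtain ⟨δ, hδ, hbd⟩ : ∃ δ : ℝ, 0 < δ ∧ ∀ x, B x x ≤ 0 → δ * ‖x‖ ^ 2 ≤ q F x := by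
    have hK : IsCompact (Metric.sphere (0 : Fin (m+1) → ℝ) 1 ∩ {x | B x x ≤ 0}) :=
      (isCompact_sphere _ _).inter_right (isClosed_le B_cont continuous_const)
    have hKn : (Metric.sphere (0 : Fin (m+1) → ℝ) 1 ∩ {x | B x x ≤ 0}).Nonempty := by
      refine ⟨Pi.single 0 1, ?_, ?_⟩
      · rw [mem_sphere_zero_iff_norm, Pi.norm_single, norm_one]
      · simp [hee]
    obtain ⟨x₀, ⟨hx1, hx2⟩, hm⟩ := hK.exists_isMinOn hKn (q_cont F).continuousOn
    have hx0 : x₀ ≠ 0 := by rintro rfl; simp at hx1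
    refine ⟨q F x₀, hpos x₀ hx0 hx2, fun x hx => ?_⟩
    by_cases h0 : x = 0
    · subst h0; simp [q, A, B]
    have hn : 0 < ‖x‖ := norm_pos_iff.2 h0
    have hmem : (‖x‖⁻¹ • x) ∈ Metric.sphere (0 : Fin (m+1) → ℝ) 1 ∩ {x | B x x ≤ 0} := by
      refine ⟨by simp [norm_smul, hn.ne'], ?_⟩
      simp only [Set.mem_ofPred_eq, B_smul_left, B_smul_right]
      have : 0 ≤ ‖x‖⁻¹ * ‖x‖⁻¹ := by positivity
      nlinarith
    have h1 : q F x₀ ≤ q F (‖x‖⁻¹ • x) := hm hmem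
    rw [q_smul] at h1
    calc q F x₀ * ‖x‖ ^ 2 ≤ (‖x‖⁻¹ ^ 2 * q F x) * ‖x‖ ^ 2 := by gcongr
      _ = q F x := by field_simp
  have hclosed : IsClosed {x : Fin (m+1) → ℝ | B x x = -1} :=
    isClosed_eq B_cont continuous_const
  obtain ⟨u, hu, hmin⟩ := (q_cont F).continuousOn.exists_isMinOn' hclosed
    (x₀ := Pi.single (0 : Fin (m+1)) (1 : ℝ)) hee (by
      set M := q F (Pi.single (0 : Fin (m+1)) (1 : ℝ)) with hM
      have hM0 : 0 ≤ M := (hpos _ (time_ne _ (by linarith)) (by linarith)).le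
      rw [Filter.eventually_inf_principal]
      have htend := tendsto_norm_cocompact_atTop (E := Fin (m+1) → ℝ)
      filter_upwards [htend.eventually_ge_atTop (max 1 (M / δ))] with x hx hxB
      have hxB' : B x x = -1 := hxB
      have h1 := hbd x (by linarith)
      have h2 : 1 ≤ ‖x‖ := le_trans (le_max_left _ _) hx
      have h3 : M / δ ≤ ‖x‖ := le_trans (le_max_right _ _) hx
      have h4 : M ≤ δ * ‖x‖ := by rwa [div_le_iff₀' hδ] at h3
      have h5 : δ * ‖x‖ ≤ δ * ‖x‖ ^ 2 := by
        apply mul_le_mul_of_nonneg_left _ hδ.le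
        nlinarith
      linarith)
  exact ⟨u, hu, fun x hx => hmin hx⟩

end main
end Aux

/-- Alignment theorem for antisymmetric rank-2 tensors: the Lorentz orbit of an
antisymmetric (Maxwell-like) matrix `F` contains an element of minimal Frobenius norm
iff `F` does not have exactly one aligned null direction. -/
theorem stmt18 {n : ℕ} (hn : 2 ≤ n)
    (F : Matrix (Fin n) (Fin n) ℝ) (hF : Fᵀ = -F) :
    (∃ Λ₀ : Matrix (Fin n) (Fin n) ℝ, IsLorentz Λ₀ ∧
      ∀ Λ : Matrix (Fin n) (Fin n) ℝ, IsLorentz Λ →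
        frobNorm (Λ₀ᵀ * F * Λ₀) ≤ frobNorm (Λᵀ * F * Λ)) ↔
    ¬ (∃ l : Fin n → ℝ, IsNull l ∧
        (∃ c : ℝ, F.mulVec l = c • ((eta n).mulVec l)) ∧
        ∀ l' : Fin n → ℝ, IsNull l' →
          (∃ c : ℝ, F.mulVec l' = c • ((eta n).mulVec l')) →
          ∃ t : ℝ, l' = t • l) := by
  obtain ⟨m, rfl⟩ : ∃ m, n = m + 1 := ⟨n - 1, by omega⟩
  rw [Aux.min_iff F hF]
  constructor
  · rintro ⟨u, hu, hmin⟩ ⟨l, hl, ⟨c, hc⟩, huniq⟩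
    refine Aux.not_unique_of_min F hF u hu hmin l
      ⟨hl, c, (Aux.aligned_iff F l c).1 hc⟩ ?_
    rintro l' ⟨hl', d, hd⟩
    exact huniq l' hl' ⟨d, (Aux.aligned_iff F l' d).2 hd⟩
  · intro h
    by_cases hex : ∃ l, Aux.AND F l
    · obtain ⟨l, hl⟩ := hex
      by_contra hcon
      apply h
      obtain ⟨hn, c, hc⟩ := hl
      refine ⟨l, hn, ⟨c, (Aux.aligned_iff F l c).2 hc⟩, ?_⟩
      rintro l' hl' ⟨d, hd⟩
      by_contra hne
      exact hcon (Aux.min_of_two F hF l l' ⟨hn, c, hc⟩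
        ⟨hl', d, (Aux.aligned_iff F l' d).1 hd⟩ hne)
    · exact Aux.min_of_none F hF fun l hl => hex ⟨l, hl⟩

end
end
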